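/- arXiv:2101.04776 — 4 statements merged into one kernel-verified Lean document; each statement's English description precedes it below -/
import Mathlib

section
/- Let X be a nonempty open convex subset of ℝⁿ and let g : X → ℝ be differentiable on X. Then g is quasiconcave on X if and only if for all x₁, x₂ ∈ X: ⟨∇g(x₁), x₂ − x₁⟩ < 0 implies g(x₂) < g(x₁). -/
open RealInnerProductSpace

section

variable {E : Type*} [NormedAddCommGroup E] [InnerProductSpace ℝ E] [CompleteSpace E]

open AffineMap in
/-- The derivative of `g` along the line through `x` and `y`, in terms of the gradient. -/
lemma hasDerivAt_comp_lineMap_gradient {g : E → ℝ} {x y : E} {t : ℝ}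
    (hg : DifferentiableAt ℝ g (lineMap x y t)) :
    HasDerivAt (fun s : ℝ => g (lineMap x y s)) ⟪gradient g (lineMap x y t), y - x⟫ t := by
  have h := hg.hasGradientAt.hasFDerivAt.comp_hasDerivAt t
    (AffineMap.hasDerivAt_lineMap (a := x) (b := y) (x := t))
  simpa [Function.comp_def] using h

/-- The gradient of a quasiconcave function makes a nonnegative inner product with every direction
pointing to a point where the function is at least as large. -/
lemma QuasiconcaveOn.inner_gradient_nonneg {X : Set E} {g : E → ℝ} {x y : E}
    (hq : QuasiconcaveOn ℝ X g) (hx : x ∈ X) (hy : y ∈ X) (hg : DifferentiableAt ℝ g x)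
    (hxy : g x ≤ g y) : 0 ≤ ⟪gradient g x, y - x⟫ := by
  have hd : HasDerivAt (fun s : ℝ => g (AffineMap.lineMap x y s)) ⟪gradient g x, y - x⟫ 0 := by
    simpa using hasDerivAt_comp_lineMap_gradient (x := x) (y := y) (t := 0) (by simpa using hg)
  refine ge_of_tendsto hd.tendsto_slope_zero_right ?_
  filter_upwards [Ioc_mem_nhdsGT (zero_lt_one' ℝ)] with t ht
  have hmem := (hq (g x)).lineMap_mem ⟨hx, le_rfl⟩ ⟨hy, hxy⟩ ⟨ht.1.le, ht.2⟩
  have hle : g x ≤ g (AffineMap.lineMap x y t) := hmem.2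
  simpa using mul_nonneg (inv_nonneg.2 ht.1.le) (sub_nonneg.2 hle)

/-- A differentiable function on a convex set is quasiconcave as soon as it decreases strictly
towards every point in a direction of strict first-order decrease. -/
lemma quasiconcaveOn_of_inner_gradient_neg {X : Set E} {g : E → ℝ} (hconv : Convex ℝ X)
    (hdiff : ∀ x ∈ X, DifferentiableAt ℝ g x)
    (h : ∀ x ∈ X, ∀ y ∈ X, ⟪gradient g x, y - x⟫ < 0 → g y < g x) :
    QuasiconcaveOn ℝ X g := by
  intro r
  rw [convex_iff_segment_subset]
  rintro x ⟨hx, hrx⟩ y ⟨hy, hry⟩ z hz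
  rw [segment_eq_image_lineMap] at hz
  obtain ⟨a, ha, rfl⟩ := hz
  have hmem : ∀ t ∈ Set.Icc (0 : ℝ) 1, AffineMap.lineMap x y t ∈ X :=
    fun t ht => hconv.lineMap_mem hx hy ht
  refine ⟨hmem a ha, ?_⟩
  by_contra! hlt
  set φ : ℝ → ℝ := fun t => g (AffineMap.lineMap x y t) with hφ
  have hderiv : ∀ t ∈ Set.Icc (0 : ℝ) 1,
      HasDerivAt φ ⟪gradient g (AffineMap.lineMap x y t), y - x⟫ t :=
    fun t ht => hasDerivAt_comp_lineMap_gradient (hdiff _ (hmem t ht))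
  have hcont : ContinuousOn φ (Set.Icc a 1) := fun t ht =>
    (hderiv t ⟨ha.1.trans ht.1, ht.2⟩).continuousAt.continuousWithinAt
  have hcompact : IsCompact (Set.Icc a 1 ∩ φ ⁻¹' Set.Ici r) :=
    isCompact_Icc.of_isClosed_subset
      (hcont.preimage_isClosed_of_isClosed isClosed_Icc isClosed_Ici) Set.inter_subset_left
  obtain ⟨s, ⟨hs, hrs⟩, hleast⟩ :=
    hcompact.exists_isLeast ⟨1, ⟨ha.2, le_rfl⟩, by simpa [hφ] using hry⟩
  have hrs : r ≤ φ s := hrs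
  have has : a < s := lt_of_le_of_ne hs.1 fun hEq => (hEq ▸ hlt : φ s < r).not_ge hrs
  obtain ⟨c, hc, hslope⟩ := exists_hasDerivAt_eq_slope φ
    (fun t => ⟪gradient g (AffineMap.lineMap x y t), y - x⟫) has
    (hcont.mono (Set.Icc_subset_Icc_right hs.2))
    fun t ht => hderiv t ⟨ha.1.trans ht.1.le, ht.2.le.trans hs.2⟩
  have hc01 : c ∈ Set.Icc (0 : ℝ) 1 := ⟨ha.1.trans hc.1.le, hc.2.le.trans hs.2⟩
  have hcr : φ c < r := by
    by_contra! hge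
    exact hc.2.not_ge (hleast ⟨⟨hc.1.le, hc01.2⟩, hge⟩)
  have hpos : 0 < ⟪gradient g (AffineMap.lineMap x y c), y - x⟫ := by
    rw [hslope]
    exact div_pos (sub_pos.2 (hlt.trans_le hrs)) (sub_pos.2 has)
  have hdir : x - AffineMap.lineMap x y c = -(c • (y - x)) := by
    simp [AffineMap.lineMap_apply_module']
  have hneg : ⟪gradient g (AffineMap.lineMap x y c), x - AffineMap.lineMap x y c⟫ < 0 := by
    rw [hdir, inner_neg_right, inner_smul_right]
    exact neg_neg_of_pos (mul_pos (ha.1.trans_lt hc.1) hpos)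
  exact ((h _ (hmem c hc01) x hx hneg).trans hcr).not_ge hrx

end

theorem stmt_0 {n : ℕ} (X : Set (EuclideanSpace ℝ (Fin n)))
    (g : EuclideanSpace ℝ (Fin n) → ℝ)
    (hne : X.Nonempty) (hopen : IsOpen X) (hconv : Convex ℝ X)
    (hdiff : ∀ x ∈ X, DifferentiableAt ℝ g x) :
    QuasiconcaveOn ℝ X g ↔
      ∀ x₁ ∈ X, ∀ x₂ ∈ X, ⟪gradient g x₁, x₂ - x₁⟫ < 0 → g x₂ < g x₁ := by
  refine ⟨fun hq x₁ h₁ x₂ h₂ hlt => ?_, quasiconcaveOn_of_inner_gradient_neg hconv hdiff⟩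
  contrapose! hlt
  exact hq.inner_gradient_nonneg h₁ h₂ (hdiff x₁ h₁) hlt
end

section
/- Let X be a nonempty open convex subset of ℝⁿ and let g : X → ℝ be differentiable. If g is pseudoconcave on X, then g is semi-strictly quasiconcave on X. -/
open RealInnerProductSpace

/-- `g` is pseudoconcave on `X` (differentiable case). -/
def PseudoconcaveOn {n : ℕ} (X : Set (EuclideanSpace ℝ (Fin n)))
    (g : EuclideanSpace ℝ (Fin n) → ℝ) : Prop :=
  ∀ x₁ ∈ X, ∀ x₂ ∈ X, ⟪gradient g x₁, x₂ - x₁⟫ ≤ 0 → g x₂ ≤ g x₁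

/-- `g` is semi-strictly quasiconcave on `X`. -/
def SemiStrictlyQuasiconcaveOn {E : Type*} [NormedAddCommGroup E] [NormedSpace ℝ E]
    (X : Set E) (g : E → ℝ) : Prop :=
  ∀ x₁ ∈ X, ∀ x₂ ∈ X, x₁ ≠ x₂ → g x₁ < g x₂ →
    ∀ l ∈ Set.Ioo (0 : ℝ) 1, g x₁ < g ((1 - l) • x₁ + l • x₂)

/-- A continuous function on `[a, b]` with an interior value at most its value at `a`, and with
`f a < f b`, attains its minimum over `[a, b]` in the interior. -/
theorem exists_mem_Ioo_isMinOn_Icc {f : ℝ → ℝ} {a b l : ℝ} (hf : ContinuousOn f (Set.Icc a b))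
    (hab : f a < f b) (hl : l ∈ Set.Ioo a b) (hla : f l ≤ f a) :
    ∃ c ∈ Set.Ioo a b, IsMinOn f (Set.Icc a b) c := by
  have hle : a ≤ b := (hl.1.trans hl.2).le
  obtain ⟨c, hc, hmin⟩ := isCompact_Icc.exists_isMinOn (Set.nonempty_Icc.2 hle) hf
  have hca : f c ≤ f a := hmin (Set.left_mem_Icc.2 hle)
  rcases hc.1.eq_or_lt with rfl | hac
  · exact ⟨l, hl, fun x hx => hla.trans (hmin hx)⟩
  · refine ⟨c, ⟨hac, hc.2.lt_of_ne ?_⟩, hmin⟩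
    rintro rfl
    exact hab.not_ge hca

theorem stmt_2 {n : ℕ} (X : Set (EuclideanSpace ℝ (Fin n)))
    (g : EuclideanSpace ℝ (Fin n) → ℝ)
    (hne : X.Nonempty) (hopen : IsOpen X) (hconv : Convex ℝ X)
    (hdiff : ∀ x ∈ X, DifferentiableAt ℝ g x)
    (hpc : PseudoconcaveOn X g) :
    SemiStrictlyQuasiconcaveOn X g := by
  intro x₁ h₁ x₂ h₂ _ hlt l hl
  by_contra! hle
  set φ : ℝ → ℝ := fun t => g (AffineMap.lineMap x₁ x₂ t) with hφ
  have hmem : ∀ t ∈ Set.Icc (0 : ℝ) 1, AffineMap.lineMap x₁ x₂ t ∈ X :=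
    fun t ht => hconv.lineMap_mem h₁ h₂ ht
  have hderiv : ∀ t ∈ Set.Icc (0 : ℝ) 1,
      HasDerivAt φ ⟪gradient g (AffineMap.lineMap x₁ x₂ t), x₂ - x₁⟫ t := by
    intro t ht
    exact (hdiff _ (hmem t ht)).hasGradientAt.hasFDerivAt.comp_hasDerivAt t
      (AffineMap.hasDerivAt_lineMap (a := x₁) (b := x₂))
  obtain ⟨c, hc, hmin⟩ := exists_mem_Ioo_isMinOn_Icc (f := φ)
    (fun t ht => (hderiv t ht).continuousAt.continuousWithinAt)
    (by simpa [hφ] using hlt) hl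
    (by simpa [hφ, AffineMap.lineMap_apply_module] using hle)
  have hcI := Set.Ioo_subset_Icc_self hc
  have hzero := (hmin.isLocalMin (Icc_mem_nhds hc.1 hc.2)).hasDerivAt_eq_zero (hderiv c hcI)
  have hsub : x₂ - AffineMap.lineMap x₁ x₂ c = (1 - c) • (x₂ - x₁) := by
    rw [AffineMap.lineMap_apply_module]
    module
  have hge : g x₂ ≤ φ c :=
    hpc _ (hmem c hcI) x₂ h₂ (by rw [hsub, inner_smul_right, hzero, mul_zero])
  have hc0 : φ c ≤ g x₁ := by
    simpa [hφ] using hmin (Set.left_mem_Icc.2 (zero_le_one' ℝ))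
  exact hlt.not_ge (hge.trans hc0)
end

section
/- For i = 1,…,m let Xᵢ be a nonempty open convex subset of ℝ^{nᵢ} and let fᵢ : Xᵢ → (0,∞) be a positive non-constant function, and define f on X = X₁ × … × X_m by f(x₁,…,x_m) = ∏_{i=1}^m fᵢ(xᵢ). If f is quasiconcave on X, then all the functions fᵢ except possibly one are log-concave; i.e., there do not exist two distinct indices i ≠ j such that both fᵢ and f_j fail to be log-concave. -/
open Set

/-- The function `(x, y) ↦ u x + v y` is quasiconcave on `A ×ˢ B`. -/
def SumQuasiconcaveOn {E F : Type*} [AddCommGroup E] [Module ℝ E] [AddCommGroup F] [Module ℝ F]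
    (A : Set E) (B : Set F) (u : E → ℝ) (v : F → ℝ) : Prop :=
  ∀ ⦃x⦄, x ∈ A → ∀ ⦃x'⦄, x' ∈ A → ∀ ⦃y⦄, y ∈ B → ∀ ⦃y'⦄, y' ∈ B → ∀ ⦃a b : ℝ⦄, 0 ≤ a → 0 ≤ b →
    a + b = 1 → min (u x + v y) (u x' + v y') ≤ u (a • x + b • x') + v (a • y + b • y')

namespace SumQuasiconcaveOn

section Module

variable {E F : Type*} [AddCommGroup E] [Module ℝ E] [AddCommGroup F] [Module ℝ F]
  {A : Set E} {B : Set F} {u : E → ℝ} {v : F → ℝ}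

theorem symm (h : SumQuasiconcaveOn A B u v) : SumQuasiconcaveOn B A v u := by
  intro y hy y' hy' x hx x' hx' a b ha hb hab
  simpa only [add_comm] using h hx hx' hy hy' ha hb hab

/-- Restriction to an affine line in each of the two variables. -/
theorem comp_lineMap (h : SumQuasiconcaveOn A B u v) (x x' : E) (y y' : F) :
    SumQuasiconcaveOn (AffineMap.lineMap (k := ℝ) x x' ⁻¹' A)
      (AffineMap.lineMap (k := ℝ) y y' ⁻¹' B)
      (u ∘ AffineMap.lineMap (k := ℝ) x x') (v ∘ AffineMap.lineMap (k := ℝ) y y') := by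
  intro s hs s' hs' t ht t' ht' a b ha hb hab
  have := h hs hs' ht ht' ha hb hab
  simp only [Function.comp_apply]
  rwa [Convex.combo_affine_apply hab, Convex.combo_affine_apply hab]

/-- If `u` drops by at least `η` immediately after `x` along a segment, then `v` satisfies a
strengthened form of quasiconcavity. -/
theorem min_le_of_drop (h : SumQuasiconcaveOn A B u v) (hA : Convex ℝ A) {x z : E} (hx : x ∈ A)
    (hz : z ∈ A) {η : ℝ}
    (hdrop : ∀ t : ℝ, 0 < t → t ≤ 1 → u (AffineMap.lineMap x z t) ≤ u x - η)
    {y y' : F} (hy : y ∈ B) (hy' : y' ∈ B) {a b : ℝ} (ha : 0 ≤ a) (hb : 0 < b) (hab : a + b = 1) :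
    min (v y + η) (v y') ≤ v (a • y + b • y') := by
  set S : Set ℝ := (fun t : ℝ => u (AffineMap.lineMap x z t)) '' Ioc 0 1
  have hne : S.Nonempty := ⟨_, 1, by simp, rfl⟩
  have hbdd : BddAbove S := ⟨u x - η, by rintro _ ⟨t, ht, rfl⟩; exact hdrop t ht.1 ht.2⟩
  refine le_of_forall_pos_le_add fun δ hδ => ?_
  obtain ⟨_, ⟨t, ht, rfl⟩, hlt⟩ := exists_lt_of_lt_csSup hne (sub_lt_self (sSup S) hδ)
  have hbt : 0 < b * t := mul_pos hb ht.1
  have hbt1 : b * t ≤ 1 := by nlinarith [ht.1, ht.2]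
  have hmem : AffineMap.lineMap x z t ∈ A := hA.lineMap_mem hx hz ⟨ht.1.le, ht.2⟩
  have key := h hx hmem hy hy' ha hb.le hab
  have hcombo : a • x + b • AffineMap.lineMap x z t = AffineMap.lineMap x z (b * t) := by
    obtain rfl : a = 1 - b := by linarith
    simp only [AffineMap.lineMap_apply_module]
    module
  rw [hcombo] at key
  have hle : u (AffineMap.lineMap x z (b * t)) ≤ sSup S :=
    le_csSup hbdd ⟨b * t, ⟨hbt, hbt1⟩, rfl⟩
  have hd := hdrop _ hbt hbt1
  simp only at hlt
  rcases min_le_iff.1 key with hk | hk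
  · exact (min_le_left _ _).trans (by linarith)
  · exact (min_le_right _ _).trans (by linarith)

end Module

/-- If `v` is not constant, then `u` cannot drop immediately after a point along a segment. -/
theorem not_drop {A B : Set ℝ} {u v : ℝ → ℝ} (h : SumQuasiconcaveOn A B u v) (hA : Convex ℝ A)
    (hB : IsOpen B) {c d : ℝ} (hc : c ∈ B) (hd : d ∈ B) (hcd : v c < v d)
    {x z : ℝ} (hx : x ∈ A) (hz : z ∈ A) {η : ℝ} (hη : 0 < η)
    (hdrop : ∀ t : ℝ, 0 < t → t ≤ 1 → u (AffineMap.lineMap x z t) ≤ u x - η) : False := by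
  have key := fun {y y' a b} hy hy' ha hb hab =>
    h.min_le_of_drop hA hx hz hdrop (y := y) (y' := y') (a := a) (b := b) hy hy' ha hb hab
  have hcont : Continuous fun r : ℝ => c - r * (d - c) := by fun_prop
  obtain ⟨ε, hε, hball⟩ := Metric.isOpen_iff.1 (hB.preimage hcont) 0 (by simpa using hc)
  set p : ℝ → ℝ := fun r => c - r * (d - c) with hp
  have hmem : ∀ r, 0 ≤ r → r < ε → p r ∈ B := fun r h0 h1 =>
    hball (by simpa [abs_of_nonneg h0] using h1)
  -- Moving away from `d`, the function `v` decreases by at least `η` at every step.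
  have hstep : ∀ r s, 0 ≤ r → r < s → s < ε → v (p r) < v d → v (p s) ≤ v (p r) - η := by
    intro r s h0 hrs hs hlt
    have h1 : (0 : ℝ) < 1 + s := by linarith
    have := key (hmem s (by linarith) hs) hd (a := (1 + r) / (1 + s)) (b := (s - r) / (1 + s))
      (by positivity) (div_pos (by linarith) h1) (by field_simp; ring)
    have he : ((1 + r) / (1 + s)) • p s + ((s - r) / (1 + s)) • d = p r := by
      simp only [hp, smul_eq_mul]
      field_simp
      ring
    rw [he] at this
    rcases min_le_iff.1 this with hk | hk <;> linarith
  have hp0 : p 0 = c := by simp [hp]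
  have hanti : ∀ r, 0 ≤ r → r < ε → v (p r) < v d := by
    intro r h0 h1
    rcases h0.eq_or_lt with rfl | h0
    · rwa [hp0]
    · have := hstep 0 r le_rfl h0 h1 (by rwa [hp0])
      rw [hp0] at this
      linarith
  set S : Set ℝ := (fun r => v (p r)) '' Ico 0 (ε / 2)
  have hbdd : BddBelow S := by
    refine ⟨v (p (ε / 2)), ?_⟩
    rintro _ ⟨r, hr, rfl⟩
    have := hstep r (ε / 2) hr.1 hr.2 (by linarith) (hanti r hr.1 (by linarith [hr.2]))
    simp only
    linarith
  have hne : S.Nonempty := ⟨_, 0, by simpa using hε, rfl⟩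
  obtain ⟨_, ⟨r, hr, rfl⟩, hlt⟩ := exists_lt_of_csInf_lt hne (lt_add_of_pos_right (sInf S) hη)
  obtain ⟨s, hrs, hs⟩ := exists_between hr.2
  have h1 := hstep r s hr.1 hrs (by linarith) (hanti r hr.1 (by linarith [hr.2]))
  have h2 : sInf S ≤ v (p s) := csInf_le hbdd ⟨s, ⟨hr.1.trans hrs.le, hs⟩, rfl⟩
  simp only at hlt
  linarith

/-- If `v` is not constant, then `u` is lower semicontinuous. -/
theorem lowerSemicontinuousOn {A B : Set ℝ} {u v : ℝ → ℝ} (h : SumQuasiconcaveOn A B u v)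
    (hAo : IsOpen A) (hA : Convex ℝ A) (hB : IsOpen B) {c d : ℝ} (hc : c ∈ B) (hd : d ∈ B)
    (hcd : v c < v d) : LowerSemicontinuousOn u A := by
  intro x hx w hw
  by_contra hcon
  -- On at least one side of `x` every neighbourhood contains a point where `u ≤ w`.
  obtain ⟨z, hz, hfreq⟩ : ∃ z ∈ A, ∀ t : ℝ, 0 < t → t ≤ 1 → ∃ s : ℝ, 0 < s ∧ s < t ∧
      u (AffineMap.lineMap x z s) ≤ w := by
    obtain ⟨ε, hε, hball⟩ := Metric.isOpen_iff.1 hAo x hx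
    by_contra! hno
    have hzr : x + ε / 2 ∈ A := hball (by simp [abs_of_pos hε, hε])
    have hzl : x - ε / 2 ∈ A := hball (by simp [abs_of_pos hε, hε])
    obtain ⟨t, ht, -, htr⟩ := hno _ hzr
    obtain ⟨t', ht', -, htl⟩ := hno _ hzl
    apply hcon
    refine mem_nhdsWithin_of_mem_nhds (Metric.mem_nhds_iff.2
      ⟨min t t' * (ε / 2), by positivity, fun y hy => ?_⟩)
    rw [Metric.mem_ball, Real.dist_eq, abs_lt] at hy
    have hm1 : min t t' * (ε / 2) ≤ t * (ε / 2) := by gcongr; exact min_le_left _ _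
    have hm2 : min t t' * (ε / 2) ≤ t' * (ε / 2) := by gcongr; exact min_le_right _ _
    rcases lt_trichotomy y x with hyx | rfl | hyx
    · have := htl ((x - y) / (ε / 2)) (div_pos (by linarith) (by linarith))
        ((div_lt_iff₀ (by linarith)).2 (by linarith))
      have he : AffineMap.lineMap x (x - ε / 2) ((x - y) / (ε / 2)) = y := by
        rw [AffineMap.lineMap_apply_ring']; field_simp; ring
      rwa [he] at this
    · exact hw
    · have := htr ((y - x) / (ε / 2)) (div_pos (by linarith) (by linarith))
        ((div_lt_iff₀ (by linarith)).2 (by linarith))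
      have he : AffineMap.lineMap x (x + ε / 2) ((y - x) / (ε / 2)) = y := by
        rw [AffineMap.lineMap_apply_ring']; field_simp; ring
      rwa [he] at this
  refine h.not_drop hA hB hc hd hcd hx hz (sub_pos.2 hw) fun t ht ht1 => ?_
  obtain ⟨s, hs, hst, hsw⟩ := hfreq t ht ht1
  have hmem : AffineMap.lineMap x z t ∈ A := hA.lineMap_mem hx hz ⟨ht.le, ht1⟩
  have key := h hx hmem hc hc (a := 1 - s / t) (b := s / t)
    (by rw [sub_nonneg, div_le_one ht]; exact hst.le) (by positivity) (by ring)
  have he : (1 - s / t) • x + (s / t) • AffineMap.lineMap x z t = AffineMap.lineMap x z s := by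
    simp only [AffineMap.lineMap_apply_ring', smul_eq_mul]
    field_simp
    ring
  have hc' : (1 - s / t) • c + (s / t) • c = c := by simp only [smul_eq_mul]; ring
  rw [he, hc'] at key
  rcases min_le_iff.1 key with hk | hk <;> linarith

end SumQuasiconcaveOn

/-- A lower semicontinuous function lying strictly below its chord at some point is touched from
below by a strictly convex parabola at an interior point. -/
theorem LowerSemicontinuousOn.exists_parabola_le {u : ℝ → ℝ}
    (hu : LowerSemicontinuousOn u (Icc 0 1)) {t : ℝ} (ht : t ∈ Icc (0 : ℝ) 1)
    (hlt : u t < (1 - t) * u 0 + t * u 1) :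
    ∃ x ∈ Ioo (0 : ℝ) 1, ∃ p ε : ℝ, 0 < ε ∧
      ∀ y ∈ Icc (0 : ℝ) 1, u x + p * (y - x) + ε * (y - x) ^ 2 ≤ u y := by
  set ε := ((1 - t) * u 0 + t * u 1 - u t) / 2 with hε
  have hε0 : 0 < ε := by rw [hε]; linarith
  set q : ℝ → ℝ := fun x => ε * (x * (1 - x)) - ((1 - x) * u 0 + x * u 1) with hq
  have hqc : Continuous q := by fun_prop
  obtain ⟨x, hx, hmin⟩ := (hu.add hqc.continuousOn.lowerSemicontinuousOn).exists_isMinOn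
    ⟨t, ht⟩ isCompact_Icc
  have hmin' : ∀ y ∈ Icc (0 : ℝ) 1, u x + q x ≤ u y + q y := fun y hy => hmin hy
  have hneg : u x + q x < 0 := by
    refine (hmin' t ht).trans_lt ?_
    simp only [hq]
    nlinarith [ht.1, ht.2, mul_nonneg hε0.le (sq_nonneg (t - 1 / 2))]
  have h0 : x ≠ 0 := by rintro rfl; simp [hq] at hneg
  have h1 : x ≠ 1 := by rintro rfl; simp [hq] at hneg
  refine ⟨x, ⟨hx.1.lt_of_ne' h0, hx.2.lt_of_ne h1⟩, u 1 - u 0 + ε * (2 * x - 1), ε, hε0,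
    fun y hy => ?_⟩
  have := hmin' y hy
  simp only [hq] at this
  linarith

namespace SumQuasiconcaveOn

/-- If `u x + v y` is quasiconcave on a product of open intervals containing `[0, 1]`, then `u` and
`v` cannot both lie strictly below their chords somewhere in `[0, 1]`. -/
theorem not_lt_chord {A B : Set ℝ} {u v : ℝ → ℝ} (h : SumQuasiconcaveOn A B u v)
    (hAo : IsOpen A) (hA : Convex ℝ A) (hBo : IsOpen B) (hB : Convex ℝ B)
    (hA0 : 0 ∈ A) (hA1 : 1 ∈ A) (hB0 : 0 ∈ B) (hB1 : 1 ∈ B) {s t : ℝ} (hs : s ∈ Icc (0 : ℝ) 1)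
    (ht : t ∈ Icc (0 : ℝ) 1) (hus : u s < (1 - s) * u 0 + s * u 1)
    (hvt : v t < (1 - t) * v 0 + t * v 1) : False := by
  have hIA : Icc (0 : ℝ) 1 ⊆ A := hA.ordConnected.out hA0 hA1
  have hIB : Icc (0 : ℝ) 1 ⊆ B := hB.ordConnected.out hB0 hB1
  have hnonconst : ∀ {C : Set ℝ} {w : ℝ → ℝ} {r : ℝ}, Icc (0 : ℝ) 1 ⊆ C → r ∈ Icc (0 : ℝ) 1 →
      w r < (1 - r) * w 0 + r * w 1 → ∃ c ∈ C, ∃ d ∈ C, w c < w d := by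
    intro C w r hC hr hlt
    by_contra! hcon
    have h0 := hcon r (hC hr) 0 (hC (by simp))
    have h1 := hcon r (hC hr) 1 (hC (by simp))
    nlinarith [hr.1, hr.2]
  obtain ⟨c, hc, d, hd, hcd⟩ := hnonconst hIB ht hvt
  obtain ⟨c', hc', d', hd', hcd'⟩ := hnonconst hIA hs hus
  obtain ⟨x, hx, p, ε, hε, hu⟩ :=
    ((h.lowerSemicontinuousOn hAo hA hBo hc hd hcd).mono hIA).exists_parabola_le hs hus
  obtain ⟨y, hy, q, ε', hε', hv⟩ :=
    ((h.symm.lowerSemicontinuousOn hBo hB hAo hc' hd' hcd').mono hIB).exists_parabola_le ht hvt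
  -- A nonzero direction along which the linear parts of the two parabolas cancel.
  obtain ⟨k, l, hkl, hne⟩ : ∃ k l : ℝ, p * k + q * l = 0 ∧ 0 < ε * k ^ 2 + ε' * l ^ 2 := by
    by_cases hp : p = 0
    · exact ⟨1, 0, by simp [hp], by simpa using hε⟩
    · refine ⟨-q, p, by ring, ?_⟩
      positivity
  have hev : ∀ᶠ δ : ℝ in nhdsWithin 0 (Ioi 0), (x + δ * k ∈ Ioo (0 : ℝ) 1 ∧
      x - δ * k ∈ Ioo (0 : ℝ) 1) ∧ y + δ * l ∈ Ioo (0 : ℝ) 1 ∧ y - δ * l ∈ Ioo (0 : ℝ) 1 := by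
    apply eventually_nhdsWithin_of_eventually_nhds
    have hnhds : ∀ {g : ℝ → ℝ}, Continuous g → g 0 ∈ Ioo (0 : ℝ) 1 →
        ∀ᶠ δ in nhds 0, g δ ∈ Ioo (0 : ℝ) 1 := fun hg h0 =>
      hg.continuousAt.eventually_mem (isOpen_Ioo.mem_nhds h0)
    refine ((hnhds ?_ ?_).and (hnhds ?_ ?_)).and ((hnhds ?_ ?_).and (hnhds ?_ ?_)) <;>
      first | fun_prop | simpa using hx | simpa using hy
  obtain ⟨δ, ⟨⟨hx1, hx2⟩, hy1, hy2⟩, hδ⟩ := (hev.and self_mem_nhdsWithin).exists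
  have hI := Ioo_subset_Icc_self (a := (0 : ℝ)) (b := 1)
  have key := h (hIA (hI hx1)) (hIA (hI hx2)) (hIB (hI hy1)) (hIB (hI hy2))
    (a := 1 / 2) (b := 1 / 2) (by norm_num) (by norm_num) (by norm_num)
  have hex : (1 / 2 : ℝ) • (x + δ * k) + (1 / 2 : ℝ) • (x - δ * k) = x := by
    simp only [smul_eq_mul]; ring
  have hey : (1 / 2 : ℝ) • (y + δ * l) + (1 / 2 : ℝ) • (y - δ * l) = y := by
    simp only [smul_eq_mul]; ring
  rw [hex, hey] at key
  have hpos : 0 < δ ^ 2 * (ε * k ^ 2 + ε' * l ^ 2) := mul_pos (pow_pos hδ 2) hne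
  have hlin : δ * (p * k + q * l) = 0 := by rw [hkl, mul_zero]
  have e1 := hu _ (hI hx1)
  have e2 := hu _ (hI hx2)
  have e3 := hv _ (hI hy1)
  have e4 := hv _ (hI hy2)
  rcases min_le_iff.1 key with hk | hk <;> nlinarith

/-- If `u x + v y` is quasiconcave on a product of open convex sets, then `u` or `v` is concave. -/
theorem concaveOn_or_concaveOn {E F : Type*} [NormedAddCommGroup E] [NormedSpace ℝ E]
    [NormedAddCommGroup F] [NormedSpace ℝ F] {A : Set E} {B : Set F} {u : E → ℝ} {v : F → ℝ}
    (h : SumQuasiconcaveOn A B u v) (hAo : IsOpen A) (hA : Convex ℝ A) (hBo : IsOpen B)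
    (hB : Convex ℝ B) : ConcaveOn ℝ A u ∨ ConcaveOn ℝ B v := by
  by_contra! hcon
  obtain ⟨hu, hv⟩ := hcon
  simp only [ConcaveOn, hA, hB, true_and, not_forall, not_le, exists_prop] at hu hv
  obtain ⟨x, hx, x', hx', a, s, ha, hs, has, hlt⟩ := hu
  obtain ⟨y, hy, y', hy', b, t, hb, ht, hbt, hlt'⟩ := hv
  obtain rfl : a = 1 - s := by linarith
  obtain rfl : b = 1 - t := by linarith
  refine (h.comp_lineMap x x' y y').not_lt_chord
    (hAo.preimage AffineMap.lineMap_continuous) (hA.affine_preimage _)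
    (hBo.preimage AffineMap.lineMap_continuous) (hB.affine_preimage _)
    (by simpa) (by simpa) (by simpa) (by simpa) (s := s) (t := t)
    ⟨hs, by linarith⟩ ⟨ht, by linarith⟩ ?_ ?_
  · simpa [AffineMap.lineMap_apply_module] using hlt
  · simpa [AffineMap.lineMap_apply_module] using hlt'

end SumQuasiconcaveOn

/-- Two distinct factors of a quasiconcave product of positive functions have logarithms whose sum
is quasiconcave. -/
theorem QuasiconcaveOn.sumQuasiconcaveOn_log {ι : Type*} [Fintype ι] [DecidableEq ι]
    {E : ι → Type*} [∀ i, AddCommGroup (E i)] [∀ i, Module ℝ (E i)] {X : ∀ i, Set (E i)}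
    {f : ∀ i, E i → ℝ} (hne : ∀ i, (X i).Nonempty) (hconv : ∀ i, Convex ℝ (X i))
    (hpos : ∀ i, ∀ x ∈ X i, 0 < f i x)
    (hqc : QuasiconcaveOn ℝ (univ.pi X) (fun x => ∏ i, f i (x i))) {i j : ι} (hij : i ≠ j) :
    SumQuasiconcaveOn (X i) (X j) (fun x => Real.log (f i x)) (fun y => Real.log (f j y)) := by
  choose z hz using hne
  set w : E i → E j → ∀ k, E k := fun x y => Function.update (Function.update z i x) j y with hw
  have hwmem : ∀ {x y}, x ∈ X i → y ∈ X j → w x y ∈ univ.pi X := by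
    intro x y hx hy k _
    by_cases hkj : k = j
    · subst hkj; simpa [hw] using hy
    · by_cases hki : k = i
      · subst hki; simpa [hw, hkj] using hx
      · simpa [hw, hkj, hki] using hz k
  set P := ∏ k ∈ (Finset.univ.erase i).erase j, f k (z k)
  have hPpos : 0 < P := Finset.prod_pos fun k _ => hpos k _ (hz k)
  have hprod : ∀ x y, ∏ k, f k (w x y k) = f i x * f j y * P := by
    intro x y
    rw [← Finset.mul_prod_erase Finset.univ _ (Finset.mem_univ i),
      ← Finset.mul_prod_erase (Finset.univ.erase i) _
        (Finset.mem_erase.2 ⟨hij.symm, Finset.mem_univ j⟩), ← mul_assoc]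
    congr 1
    · simp [hw, hij]
    · refine Finset.prod_congr rfl fun k hk => ?_
      simp only [Finset.mem_erase] at hk
      simp [hw, hk.1, hk.2.1]
  intro x hx x' hx' y hy y' hy' a b ha hb hab
  have hcombo : a • w x y + b • w x' y' = w (a • x + b • x') (a • y + b • y') := by
    funext k
    by_cases hkj : k = j
    · subst hkj; simp [hw]
    · by_cases hki : k = i
      · subst hki; simp [hw, hkj]
      · simp [hw, hkj, hki, ← add_smul, hab]
  have key := (hqc (min (f i x * f j y * P) (f i x' * f j y' * P))
    ⟨hwmem hx hy, by simp only [hprod]; exact min_le_left _ _⟩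
    ⟨hwmem hx' hy', by simp only [hprod]; exact min_le_right _ _⟩ ha hb hab).2
  simp only [hcombo, hprod] at key
  have hpx := hpos i x hx
  have hpx' := hpos i x' hx'
  have hpy := hpos j y hy
  have hpy' := hpos j y' hy'
  have hpxx := hpos i _ (hconv i hx hx' ha hb hab)
  have hpyy := hpos j _ (hconv j hy hy' ha hb hab)
  simp only [← Real.log_mul hpx.ne' hpy.ne', ← Real.log_mul hpx'.ne' hpy'.ne',
    ← Real.log_mul hpxx.ne' hpyy.ne']
  rcases min_le_iff.1 key with hk | hk
  · exact min_le_of_left_le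
      (Real.log_le_log (mul_pos hpx hpy) (le_of_mul_le_mul_right hk hPpos))
  · exact min_le_of_right_le
      (Real.log_le_log (mul_pos hpx' hpy') (le_of_mul_le_mul_right hk hPpos))

theorem stmt_8 {m : ℕ} (n : Fin m → ℕ)
    (X : ∀ i, Set (EuclideanSpace ℝ (Fin (n i))))
    (f : ∀ i, EuclideanSpace ℝ (Fin (n i)) → ℝ)
    (hne : ∀ i, (X i).Nonempty) (hopen : ∀ i, IsOpen (X i))
    (hconv : ∀ i, Convex ℝ (X i))
    (hpos : ∀ i, ∀ xi ∈ X i, 0 < f i xi)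
    (hnc : ∀ i, ∃ a ∈ X i, ∃ b ∈ X i, f i a ≠ f i b)
    (hqc : QuasiconcaveOn ℝ (Set.univ.pi X) (fun x => ∏ i, f i (x i))) :
    ¬ ∃ i j : Fin m, i ≠ j ∧
        ¬ ConcaveOn ℝ (X i) (fun xi => Real.log (f i xi)) ∧
        ¬ ConcaveOn ℝ (X j) (fun xj => Real.log (f j xj)) := by
  rintro ⟨i, j, hij, hi, hj⟩
  exact ((hqc.sumQuasiconcaveOn_log hne hconv hpos hij).concaveOn_or_concaveOn (hopen i)
    (hconv i) (hopen j) (hconv j)).elim hi hj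
end

section
/- Let X be a nonempty open convex subset of ℝⁿ and let f : X → ℝ be upper semicontinuous and quasiconcave, and let x, x̄ ∈ X. If x belongs to the closure of the strict upper level set Uˢ(f, f(x̄)) = {y ∈ X : f(y) > f(x̄)}, then ⟨x̄*, x − x̄⟩ ≥ 0 for every x̄* ∈ ∂̂^{D+}f(x̄). -/
open RealInnerProductSpace

/-- The upper-Dini superdifferential of `f` at `x`. -/
def upperDiniSuper {n : ℕ} (f : EuclideanSpace ℝ (Fin n) → ℝ)
    (x : EuclideanSpace ℝ (Fin n)) : Set (EuclideanSpace ℝ (Fin n)) :=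
  {xs | ∀ v : EuclideanSpace ℝ (Fin n),
    Filter.liminf (fun t : ℝ => (f (x + t • v) - f x) / t) (nhdsWithin 0 (Set.Ioi 0)) ≤ ⟪xs, v⟫}

/-- The real-valued `liminf` of an eventually nonnegative function is nonnegative, even when the
function is not frequently bounded above, since the supremum of an unbounded set of reals is `0`. -/
lemma Real.liminf_nonneg_of_eventually {α : Type*} {l : Filter α} {u : α → ℝ}
    (h : ∀ᶠ t in l, 0 ≤ u t) : 0 ≤ Filter.liminf u l := by
  rw [Filter.liminf_eq]
  by_cases hb : BddAbove {a | ∀ᶠ t in l, a ≤ u t}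
  · exact le_csSup hb h
  · exact (Real.sSup_of_not_bddAbove hb).ge

/-- Along a segment from `x` to a point with a value at least as large, the difference quotients
at `x` of a quasiconcave function are eventually nonnegative. -/
lemma QuasiconcaveOn.eventually_nonneg_slope {E : Type*} [AddCommGroup E] [Module ℝ E]
    {X : Set E} {f : E → ℝ} (hf : QuasiconcaveOn ℝ X f) {x y : E} (hx : x ∈ X) (hy : y ∈ X)
    (hxy : f x ≤ f y) :
    ∀ᶠ t in nhdsWithin (0 : ℝ) (Set.Ioi 0), 0 ≤ (f (x + t • (y - x)) - f x) / t := by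
  filter_upwards [Ioo_mem_nhdsGT (zero_lt_one' ℝ)] with t ht
  have hmem := (hf (f x)).add_smul_sub_mem ⟨hx, le_rfl⟩ ⟨hy, hxy⟩ ⟨ht.1.le, ht.2.le⟩
  exact div_nonneg (sub_nonneg.mpr hmem.2) ht.1.le

theorem stmt_15 {n : ℕ} (X : Set (EuclideanSpace ℝ (Fin n)))
    (f : EuclideanSpace ℝ (Fin n) → ℝ)
    (hne : X.Nonempty) (hopen : IsOpen X) (hconv : Convex ℝ X)
    (husc : UpperSemicontinuousOn f X)
    (hqc : QuasiconcaveOn ℝ X f)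
    (x xbar : EuclideanSpace ℝ (Fin n)) (hx : x ∈ X) (hxbar : xbar ∈ X)
    (hcl : x ∈ closure {y ∈ X | f y > f xbar}) :
    ∀ xs ∈ upperDiniSuper f xbar, 0 ≤ ⟪xs, x - xbar⟫ := by
  intro xs hxs
  have hclosed : IsClosed {y : EuclideanSpace ℝ (Fin n) | 0 ≤ ⟪xs, y - xbar⟫} :=
    isClosed_le continuous_const (by fun_prop)
  refine closure_minimal (fun y hy => ?_) hclosed hcl
  exact (Real.liminf_nonneg_of_eventually
    (hqc.eventually_nonneg_slope hxbar hy.1 hy.2.le)).trans (hxs (y - xbar))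
end
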